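/- Let n ∈ ℕ₀, λ ∈ ℂ with λ+1 not a nonpositive integer, and x ∈ (−1,1). Then the quadratic transformation P_n^{(λ,−1/2)}(2x²−1) = (2^λ Γ(λ+n+1)/(n! (1−x²)^{λ/2})) 𝖯_{2n+λ}^{−λ}(x) holds, relating the Jacobi polynomial of argument 2x²−1 to the Ferrers function of the first kind of even degree shift. -/

import Mathlib

/-- Pochhammer symbol `(a)_k = a (a+1) ⋯ (a+k-1)` for complex `a`. -/
noncomputable def cpoch (a : ℂ) (k : ℕ) : ℂ := ∏ i ∈ Finset.range k, (a + i)

/-- Gauss hypergeometric series `₂F₁(a, b; c; z)`. -/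
noncomputable def hyp2F1 (a b c z : ℂ) : ℂ :=
  ∑' k : ℕ, cpoch a k * cpoch b k / (cpoch c k * (Nat.factorial k : ℂ)) * z ^ k

/-- Ferrers function of the first kind `𝖯_ν^{−μ}(x)`. -/
noncomputable def ferrersP (ν μ : ℂ) (x : ℝ) : ℂ :=
  (1 / Complex.Gamma (μ + 1)) * (((1 - x) / (1 + x) : ℝ) : ℂ) ^ (μ / 2) *
    hyp2F1 (-ν) (ν + 1) (μ + 1) (((1 - x) / 2 : ℝ) : ℂ)

/-- Jacobi polynomial `P_n^{(α,β)}(x)`. -/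
noncomputable def jacobiP (n : ℕ) (α β : ℂ) (x : ℝ) : ℂ :=
  cpoch (α + 1) n / (Nat.factorial n : ℂ) *
    hyp2F1 (-(n : ℂ)) ((n : ℂ) + α + β + 1) (α + 1) (((1 - x) / 2 : ℝ) : ℂ)

open PowerSeries in
/-- The hypergeometric differential operator
`X (1 - X) F'' + (c - (a + b + 1) X) F' - a b F` on formal power series. -/
noncomputable def hypOp (a b c : ℂ) (F : PowerSeries ℂ) : PowerSeries ℂ :=
  X * (1 - X) * d⁄dX ℂ (d⁄dX ℂ F) + (C c - C (a + b + 1) * X) * d⁄dX ℂ F - C (a * b) * F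

/-- The Gauss hypergeometric series as a formal power series. -/
noncomputable def hypSeries (a b c : ℂ) : PowerSeries ℂ :=
  PowerSeries.mk fun k => cpoch a k * cpoch b k / (cpoch c k * (Nat.factorial k : ℂ))

/-- The terminating hypergeometric series `₂F₁(-n, b; c; X)` as a polynomial. -/
noncomputable def hypPoly (n : ℕ) (b c : ℂ) : Polynomial ℂ :=
  PowerSeries.trunc (n + 1) (hypSeries (-(n : ℂ)) b c)

/-- The binomial series `(1 - X) ^ (-a)` as a formal power series. -/
noncomputable def binSeries (a : ℂ) : PowerSeries ℂ :=
  PowerSeries.mk fun k => cpoch a k / (Nat.factorial k : ℂ)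

theorem cpoch_zero (a : ℂ) : cpoch a 0 = 1 := by simp [cpoch]

theorem cpoch_succ (a : ℂ) (k : ℕ) : cpoch a (k + 1) = cpoch a k * (a + k) := by
  simp [cpoch, Finset.prod_range_succ]

theorem cpoch_eq_eval_ascPochhammer (a : ℂ) (k : ℕ) :
    cpoch a k = (ascPochhammer ℂ k).eval a := by
  induction k with
  | zero => simp [cpoch_zero]
  | succ k ih => rw [cpoch_succ, ih, ascPochhammer_succ_eval]

theorem cpoch_ne_zero {c : ℂ} (hc : ∀ k : ℕ, c ≠ -(k : ℂ)) (k : ℕ) : cpoch c k ≠ 0 :=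
  Finset.prod_ne_zero_iff.2 fun i _ h => hc i (eq_neg_of_add_eq_zero_left h)

theorem cpoch_neg_natCast_of_lt {n k : ℕ} (h : n < k) : cpoch (-(n : ℂ)) k = 0 :=
  Finset.prod_eq_zero (Finset.mem_range.2 h) (by simp)

theorem coeff_hypOp (a b c : ℂ) (F : PowerSeries ℂ) (k : ℕ) :
    PowerSeries.coeff k (hypOp a b c F) =
      (k + 1) * (c + k) * PowerSeries.coeff (k + 1) F
        - (a + k) * (b + k) * PowerSeries.coeff k F := by
  rw [hypOp]
  obtain ⟨s, hs⟩ : ∃ s, s = a + b + 1 := ⟨_, rfl⟩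
  obtain ⟨q, hq⟩ : ∃ q, q = a * b := ⟨_, rfl⟩
  rw [← hs, ← hq, show (a + k) * (b + k) = q + (s - 1) * k + k ^ 2 by rw [hs, hq]; ring]
  have h : PowerSeries.X * (1 - PowerSeries.X) *
        PowerSeries.derivative ℂ (PowerSeries.derivative ℂ F)
      + (PowerSeries.C c - PowerSeries.C s * PowerSeries.X) * PowerSeries.derivative ℂ F
      - PowerSeries.C q * F =
      PowerSeries.X * PowerSeries.derivative ℂ (PowerSeries.derivative ℂ F)
        - PowerSeries.X * (PowerSeries.X * PowerSeries.derivative ℂ (PowerSeries.derivative ℂ F))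
        + PowerSeries.C c * PowerSeries.derivative ℂ F
        - PowerSeries.C s * (PowerSeries.X * PowerSeries.derivative ℂ F)
        - PowerSeries.C q * F := by
    ring
  simp only [h, map_add, map_sub, PowerSeries.coeff_C_mul]
  rcases k with _ | _ | k <;>
    simp only [PowerSeries.coeff_succ_X_mul, PowerSeries.coeff_zero_X_mul,
      PowerSeries.coeff_derivative] <;> push_cast <;> ring

theorem hypOp_hypSeries {c : ℂ} (hc : ∀ k : ℕ, c ≠ -(k : ℂ)) (a b : ℂ) :
    hypOp a b c (hypSeries a b c) = 0 := by
  ext k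
  rw [coeff_hypOp, hypSeries, PowerSeries.coeff_mk, PowerSeries.coeff_mk, cpoch_succ, cpoch_succ,
    cpoch_succ, Nat.factorial_succ]
  have h1 := cpoch_ne_zero hc k
  have h2 : c + k ≠ 0 := fun h => hc k (eq_neg_of_add_eq_zero_left h)
  have h3 : (Nat.factorial k : ℂ) ≠ 0 := by exact_mod_cast Nat.factorial_ne_zero k
  have h4 : (k : ℂ) + 1 ≠ 0 := by exact_mod_cast Nat.succ_ne_zero k
  push_cast
  simp only [map_zero]
  field_simp
  ring

theorem eq_hypSeries_of_hypOp_eq_zero {a b c : ℂ} (hc : ∀ k : ℕ, c ≠ -(k : ℂ))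
    {F : PowerSeries ℂ} (hF : hypOp a b c F = 0) (h0 : PowerSeries.coeff 0 F = 1) :
    F = hypSeries a b c := by
  ext k
  induction k with
  | zero => simp [h0, hypSeries, cpoch_zero]
  | succ k ih =>
    have e1 := coeff_hypOp a b c F k
    have e2 := coeff_hypOp a b c (hypSeries a b c) k
    rw [hF] at e1
    rw [hypOp_hypSeries hc] at e2
    have h2 : c + k ≠ 0 := fun h => hc k (eq_neg_of_add_eq_zero_left h)
    have h4 : (k : ℂ) + 1 ≠ 0 := by exact_mod_cast Nat.succ_ne_zero k
    refine mul_left_cancel₀ (mul_ne_zero h4 h2) ?_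
    rw [ih] at e1
    linear_combination e2 - e1

theorem coe_hypPoly (n : ℕ) (b c : ℂ) :
    (hypPoly n b c : PowerSeries ℂ) = hypSeries (-(n : ℂ)) b c := by
  ext k
  rw [Polynomial.coeff_coe, hypPoly, PowerSeries.coeff_trunc]
  split_ifs with h
  · rfl
  · simp [hypSeries, cpoch_neg_natCast_of_lt (show n < k by omega)]

theorem hyp2F1_eq_tsum_coeff (a b c z : ℂ) :
    hyp2F1 a b c z = ∑' k, PowerSeries.coeff k (hypSeries a b c) * z ^ k := by
  simp [hyp2F1, hypSeries]

open Polynomial in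
theorem hypOp_coe (a b c : ℂ) (p : ℂ[X]) :
    hypOp a b c p = ((X * (1 - X) * derivative (derivative p)
      + (C c - C (a + b + 1) * X) * derivative p - C (a * b) * p : ℂ[X]) : PowerSeries ℂ) := by
  simp only [hypOp, PowerSeries.derivative_coe, Polynomial.coe_add, Polynomial.coe_sub,
    Polynomial.coe_mul, Polynomial.coe_C, Polynomial.coe_X, Polynomial.coe_one]

open Polynomial in
theorem hypPoly_ode {c : ℂ} (hc : ∀ k : ℕ, c ≠ -(k : ℂ)) (n : ℕ) (b : ℂ) :
    X * (1 - X) * derivative (derivative (hypPoly n b c))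
      + (C c - C (-(n : ℂ) + b + 1) * X) * derivative (hypPoly n b c)
      - C (-(n : ℂ) * b) * hypPoly n b c = 0 := by
  apply Polynomial.coe_injective ℂ
  rw [← hypOp_coe, coe_hypPoly, hypOp_hypSeries hc, Polynomial.coe_zero]

theorem hypPoly_coeff_zero (n : ℕ) (b c : ℂ) : (hypPoly n b c).coeff 0 = 1 := by
  simp [hypPoly, PowerSeries.coeff_trunc, hypSeries, cpoch_zero]

open Polynomial in
theorem hypPoly_comp_quadratic {c : ℂ} (hc : ∀ k : ℕ, c ≠ -(k : ℂ)) (n : ℕ) :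
    (hypPoly n (c + n - 1 / 2) c).comp (4 * X * (1 - X)) =
      hypPoly (2 * n) (2 * c + 2 * n - 1) c := by
  apply Polynomial.coe_injective ℂ
  rw [coe_hypPoly]
  apply eq_hypSeries_of_hypOp_eq_zero hc
  · have h := congrArg (fun q => q.comp (4 * X * (1 - X))) (hypPoly_ode hc n (c + n - 1 / 2))
    generalize hypPoly n (c + n - 1 / 2) c = p at *
    rw [hypOp_coe, ← Polynomial.coe_zero, Polynomial.coe_inj]
    have h2 : C (-(n : ℂ) + (c + n - 1 / 2) + 1) = C c + C (1 / 2) := by rw [← C_add]; ring_nf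
    have h3 : C (-(n : ℂ) * (c + n - 1 / 2)) = - C (n : ℂ) * (C c + C (n : ℂ) - C (1 / 2)) := by
      simp only [C_mul, C_add, C_sub, C_neg]
    have h4 : C (-((2 * n : ℕ) : ℂ) + (2 * c + 2 * n - 1) + 1) = 2 * C c := by
      rw [show (2 : ℂ[X]) = C 2 from rfl, ← C_mul]; push_cast; ring_nf
    have h5 : C (-((2 * n : ℕ) : ℂ) * (2 * c + 2 * n - 1)) =
        - 2 * C (n : ℂ) * (2 * C c + 2 * C (n : ℂ) - 1) := by
      rw [show (2 : ℂ[X]) = C 2 from rfl, ← C_1]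
      simp only [← C_mul, ← C_add, ← C_sub, ← C_neg]
      push_cast
      ring_nf
    have h6 : (2 : ℂ[X]) * C (1 / 2 : ℂ) = 1 := by
      rw [show (2 : ℂ[X]) = C 2 from rfl, ← C_mul]; norm_num
    rw [h2, h3] at h
    rw [h4, h5]
    simp only [sub_comp, add_comp, mul_comp, neg_comp, X_comp, C_comp, one_comp, zero_comp] at h
    simp only [derivative_comp, derivative_mul, derivative_sub, derivative_X, derivative_one,
      derivative_add, derivative_ofNat, derivative_zero]
    generalize C (1 / 2 : ℂ) = e at *
    linear_combination 4 * h +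
      (8 * X * (1 - X) * (derivative p).comp (4 * X * (1 - X))
        + 2 * C (n : ℂ) * p.comp (4 * X * (1 - X))) * h6
  · rw [Polynomial.coeff_coe, coeff_zero_eq_eval_zero, eval_comp]
    simpa [coeff_zero_eq_eval_zero] using hypPoly_coeff_zero n (c + n - 1 / 2) c

theorem binSeries_ode (a : ℂ) :
    (1 - PowerSeries.X) * PowerSeries.derivative ℂ (binSeries a) =
      PowerSeries.C a * binSeries a := by
  have h (k : ℕ) : PowerSeries.coeff (k + 1) (binSeries a) * (k + 1) =
      (a + k) * PowerSeries.coeff k (binSeries a) := by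
    have h3 : (Nat.factorial k : ℂ) ≠ 0 := by exact_mod_cast Nat.factorial_ne_zero k
    have h4 : (k : ℂ) + 1 ≠ 0 := by exact_mod_cast Nat.succ_ne_zero k
    rw [binSeries, PowerSeries.coeff_mk, PowerSeries.coeff_mk, cpoch_succ, Nat.factorial_succ]
    push_cast
    field_simp
  ext k
  rw [sub_mul, one_mul, map_sub, PowerSeries.coeff_derivative, PowerSeries.coeff_C_mul, h]
  rcases k with _ | k
  · simp
  · rw [PowerSeries.coeff_succ_X_mul, PowerSeries.coeff_derivative]
    push_cast
    ring

/-- Euler's transformation as an identity of formal power series, for the case `a + b = 1`. -/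
theorem binSeries_mul_hypSeries {c : ℂ} (hc : ∀ k : ℕ, c ≠ -(k : ℂ)) (a : ℂ) :
    binSeries (1 - c) * hypSeries (c - a) (c - 1 + a) c = hypSeries a (1 - a) c := by
  apply eq_hypSeries_of_hypOp_eq_zero hc
  · have hB := binSeries_ode (1 - c)
    have hB2 := congrArg (PowerSeries.derivative ℂ) hB
    have hU := hypOp_hypSeries hc (c - a) (c - 1 + a)
    have h1 : (1 - PowerSeries.X : PowerSeries ℂ) ≠ 0 := fun h => by
      simpa using congrArg (PowerSeries.coeff 0) h
    rw [hypOp] at hU ⊢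
    refine (mul_eq_zero.1 ?_).resolve_left h1
    generalize binSeries (1 - c) = B at *
    generalize hypSeries (c - a) (c - 1 + a) c = U at *
    simp only [Derivation.leibniz, map_sub, map_add, map_mul, smul_eq_mul,
      PowerSeries.derivative_X, PowerSeries.derivative_C, PowerSeries.derivative_one, map_one]
      at hB hB2 hU ⊢
    generalize PowerSeries.C c = c' at *
    generalize PowerSeries.C a = a' at *
    generalize PowerSeries.derivative ℂ (PowerSeries.derivative ℂ B) = B2 at *
    generalize PowerSeries.derivative ℂ B = B1 at *
    generalize PowerSeries.derivative ℂ (PowerSeries.derivative ℂ U) = U2 at *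
    generalize PowerSeries.derivative ℂ U = U1 at *
    generalize (PowerSeries.X : PowerSeries ℂ) = X at *
    linear_combination (1 - X) * B * hU + X * (1 - X) * U * hB2 +
      (2 * X * (1 - X) * U1 + (c' - 2 * X) * U  + X * (2 - c') * U) * hB
  · simp [binSeries, hypSeries, cpoch_zero]

theorem choose_eq_coeff_binSeries (a : ℂ) (k : ℕ) :
    Ring.choose (a + k - 1) k = PowerSeries.coeff k (binSeries a) := by
  have h3 : (Nat.factorial k : ℂ) ≠ 0 := by exact_mod_cast Nat.factorial_ne_zero k
  rw [binSeries, PowerSeries.coeff_mk, ← Ring.multichoose_eq, eq_div_iff h3,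
    cpoch_eq_eval_ascPochhammer, mul_comm, ← nsmul_eq_mul,
    Ring.factorial_nsmul_multichoose_eq_ascPochhammer, Polynomial.ascPochhammer_smeval_eq_eval]

theorem binSeries_term_eq (a z : ℂ) (k : ℕ) :
    (FormalMultilinearSeries.ofScalars ℂ fun n : ℕ ↦ Ring.choose (a + n - 1) n) k (fun _ => z) =
      PowerSeries.coeff k (binSeries a) * z ^ k := by
  rw [FormalMultilinearSeries.ofScalars_apply_eq, choose_eq_coeff_binSeries, smul_eq_mul]

theorem summable_norm_binSeries (a : ℂ) {z : ℂ} (hz : ‖z‖ < 1) :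
    Summable fun k => ‖PowerSeries.coeff k (binSeries a) * z ^ k‖ := by
  have hs := Complex.one_div_one_sub_cpow_hasFPowerSeriesOnBall_zero a
  have hmem : z ∈ Metric.eball (0 : ℂ) 1 := by
    rw [← ENNReal.ofReal_one, Metric.eball_ofReal]; simpa using hz
  simpa only [binSeries_term_eq] using
    FormalMultilinearSeries.summable_norm_apply _ (Metric.eball_subset_eball hs.r_le hmem)

theorem tsum_binSeries (a : ℂ) {z : ℂ} (hz : ‖z‖ < 1) :
    ∑' k, PowerSeries.coeff k (binSeries a) * z ^ k = (1 - z) ^ (-a) := by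
  have hmem : z ∈ Metric.eball (0 : ℂ) 1 := by
    rw [← ENNReal.ofReal_one, Metric.eball_ofReal]; simpa using hz
  have h := ((Complex.one_div_one_sub_cpow_hasFPowerSeriesOnBall_zero a).hasSum hmem).tsum_eq
  simpa only [binSeries_term_eq, zero_add, one_div, Complex.cpow_neg] using h

theorem hyp2F1_comm (a b c z : ℂ) : hyp2F1 a b c z = hyp2F1 b a c z := by
  simp only [hyp2F1, mul_comm (cpoch a _)]

theorem summable_norm_coeff_polynomial (p : Polynomial ℂ) (z : ℂ) :
    Summable fun k => ‖p.coeff k * z ^ k‖ :=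
  summable_of_ne_finset_zero (s := Finset.range (p.natDegree + 1)) fun k hk => by
    rw [Polynomial.coeff_eq_zero_of_natDegree_lt (by simpa using hk), zero_mul, norm_zero]

theorem tsum_coeff_polynomial (p : Polynomial ℂ) (z : ℂ) :
    ∑' k, p.coeff k * z ^ k = p.eval z := by
  rw [Polynomial.eval_eq_sum_range]
  refine tsum_eq_sum fun k hk => ?_
  rw [Polynomial.coeff_eq_zero_of_natDegree_lt (by simpa using hk), zero_mul]

theorem hyp2F1_neg_natCast (n : ℕ) (b c z : ℂ) :
    hyp2F1 (-(n : ℂ)) b c z = (hypPoly n b c).eval z := by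
  simp only [hyp2F1_eq_tsum_coeff, ← coe_hypPoly, Polynomial.coeff_coe, tsum_coeff_polynomial]

/-- Euler's transformation of a nonterminating series into a terminating one. -/
theorem hyp2F1_eq_cpow_mul_eval_hypPoly {c : ℂ} (hc : ∀ k : ℕ, c ≠ -(k : ℂ)) (m : ℕ) {z : ℂ}
    (hz : ‖z‖ < 1) :
    hyp2F1 (1 - c - m) (c + m) c z =
      (1 - z) ^ (c - 1) * (hypPoly m (2 * c + m - 1) c).eval z := by
  have h := binSeries_mul_hypSeries hc (c + m)
  rw [show c - (c + m) = -(m : ℂ) by ring, show c - 1 + (c + m) = 2 * c + m - 1 by ring,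
    show 1 - (c + m) = 1 - c - m by ring, ← coe_hypPoly] at h
  rw [hyp2F1_comm, hyp2F1_eq_tsum_coeff, ← h, ← tsum_coeff_polynomial, ← neg_sub 1 c,
    ← tsum_binSeries _ hz, tsum_mul_tsum_eq_tsum_sum_antidiagonal_of_summable_norm
      (summable_norm_binSeries _ hz) (summable_norm_coeff_polynomial _ _)]
  refine tsum_congr fun k => ?_
  rw [PowerSeries.coeff_mul, Finset.sum_mul]
  refine Finset.sum_congr rfl fun ij hij => ?_
  rw [← Finset.HasAntidiagonal.mem_antidiagonal.1 hij, pow_add, Polynomial.coeff_coe]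
  ring

theorem jacobiP_eq_ferrersP_even (n : ℕ) (lam : ℂ) (hlam : ∀ k : ℕ, lam + 1 ≠ -(k : ℂ))
    (x : ℝ) (hx : x ∈ Set.Ioo (-1 : ℝ) 1) :
    jacobiP n lam (-(1 / 2)) (2 * x ^ 2 - 1) =
      (2 : ℂ) ^ lam * Complex.Gamma (lam + n + 1) /
          ((Nat.factorial n : ℂ) * ((1 - x ^ 2 : ℝ) : ℂ) ^ (lam / 2)) *
        ferrersP (2 * (n : ℂ) + lam) lam x := by
  have hz0 : (0 : ℝ) < 1 - x := by linarith [hx.2]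
  have hz1 : (0 : ℝ) < 1 + x := by linarith [hx.1]
  have hnorm : ‖(((1 - x) / 2 : ℝ) : ℂ)‖ < 1 := by
    rw [Complex.norm_real, Real.norm_eq_abs, abs_lt]
    constructor <;> linarith
  have hgam : Complex.Gamma (lam + 1) ≠ 0 := Complex.Gamma_ne_zero hlam
  have hpoch : cpoch (lam + 1) n * Complex.Gamma (lam + 1) = Complex.Gamma (lam + n + 1) := by
    rw [cpoch_eq_eval_ascPochhammer, ← Complex.Gamma_add_nat_div_Gamma_eq _ hlam,
      div_mul_cancel₀ _ hgam, add_right_comm]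
  have hE := hyp2F1_eq_cpow_mul_eval_hypPoly hlam (2 * n) hnorm
  rw [show 1 - (lam + 1) - ((2 * n : ℕ) : ℂ) = -(2 * n + lam) by push_cast; ring,
    show lam + 1 + ((2 * n : ℕ) : ℂ) = 2 * n + lam + 1 by push_cast; ring,
    add_sub_cancel_right, Nat.cast_mul, Nat.cast_ofNat, ← hypPoly_comp_quadratic hlam n,
    Polynomial.eval_comp] at hE
  have harg : Polynomial.eval (((1 - x) / 2 : ℝ) : ℂ) (4 * Polynomial.X * (1 - Polynomial.X)) =
      (((1 - (2 * x ^ 2 - 1)) / 2 : ℝ) : ℂ) := by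
    simp only [Polynomial.eval_mul, Polynomial.eval_sub, Polynomial.eval_X, Polynomial.eval_one,
      Polynomial.eval_ofNat]
    push_cast
    ring
  have hpow : (2 : ℂ) ^ lam * ((((1 - x) / (1 + x) : ℝ) : ℂ) ^ (lam / 2) *
      (1 - (((1 - x) / 2 : ℝ) : ℂ)) ^ lam) = ((1 - x ^ 2 : ℝ) : ℂ) ^ (lam / 2) := by
    have hsq (y : ℝ) (hy : 0 < y) : (y : ℂ) ^ lam = ((y ^ 2 : ℝ) : ℂ) ^ (lam / 2) := by
      rw [pow_two, Complex.ofReal_mul, Complex.mul_cpow_ofReal_nonneg hy.le hy.le,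
        ← Complex.cpow_add _ _ (by exact_mod_cast hy.ne'), add_halves]
    rw [show (1 - (((1 - x) / 2 : ℝ) : ℂ)) = (((1 + x) / 2 : ℝ) : ℂ) by push_cast; ring,
      show (2 : ℂ) ^ lam = ((2 : ℝ) : ℂ) ^ lam by norm_num, mul_left_comm,
      ← Complex.mul_cpow_ofReal_nonneg zero_le_two (by positivity), ← Complex.ofReal_mul,
      show 2 * ((1 + x) / 2) = 1 + x by ring, hsq _ hz1,
      ← Complex.mul_cpow_ofReal_nonneg (by positivity) (by positivity), ← Complex.ofReal_mul]
    congr 2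
    field_simp
    ring
  have hden : ((1 - x ^ 2 : ℝ) : ℂ) ^ (lam / 2) ≠ 0 := by
    have : (1 - x ^ 2 : ℝ) ≠ 0 := by nlinarith
    simp only [ne_eq, Complex.cpow_eq_zero_iff, not_and_or]
    exact Or.inl (by exact_mod_cast this)
  have hfac : (Nat.factorial n : ℂ) ≠ 0 := by exact_mod_cast Nat.factorial_ne_zero n
  rw [jacobiP, ferrersP, hyp2F1_neg_natCast, hE, harg, ← hpoch,
    show (n : ℂ) + lam + -(1 / 2) + 1 = lam + 1 + n - 1 / 2 by ring]
  generalize Polynomial.eval _ (hypPoly n _ _) = P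
  rw [← hpow] at hden ⊢
  obtain ⟨h2, h34⟩ := mul_ne_zero_iff.1 hden
  obtain ⟨h3, h4⟩ := mul_ne_zero_iff.1 h34
  field_simp
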